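/- Let G be a finite simple graph on vertex set {x_1, …, x_n} without isolated vertices, and let S be an independent set of G. Then dim(G^S) = dim(G) if 0 ≤ |S| ≤ dim(G) − 1, and dim(G^S) = dim(G) + 1 if |S| = dim(G). -/

import Mathlib

/-!
Formalization of results from "Matching numbers and dimension of edge ideals"
by A. Hirano and K. Matsuda.

For a finite simple graph `G`:
* a matching is a set of pairwise disjoint edges;
* a maximal matching is one that cannot be enlarged by any edge;
* an induced matching is a matching such that no edge of `G` meets two
  distinct edges of the matching;
* `matchNum`, `minMatchNum`, `indMatchNum` are the corresponding maximum,
  minimum-maximal and maximum-induced sizes;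
* `graphDim K G` is the Krull dimension of `K[V(G)]/I(G)`, where `I(G)` is
  the edge ideal of `G`.
-/

open MvPolynomial
open scoped Classical

noncomputable section

namespace EdgeIdealPaper

variable {V : Type*}

/-- `M` is a matching of `G`: a set of pairwise disjoint edges of `G`. -/
def IsMatching (G : SimpleGraph V) (M : Finset (Sym2 V)) : Prop :=
  (M : Set (Sym2 V)) ⊆ G.edgeSet ∧
    ∀ e ∈ M, ∀ f ∈ M, e ≠ f → ∀ v : V, v ∈ e → v ∉ f

/-- `M` is a maximal matching of `G`: no edge of `G` outside `M` can be added. -/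
def IsMaximalMatching (G : SimpleGraph V) (M : Finset (Sym2 V)) : Prop :=
  IsMatching G M ∧ ∀ e ∈ G.edgeSet, e ∉ M → ¬ IsMatching G (insert e M)

/-- `M` is an induced matching of `G`: a matching such that no edge of `G`
meets two distinct edges of `M`. -/
def IsInducedMatching (G : SimpleGraph V) (M : Finset (Sym2 V)) : Prop :=
  IsMatching G M ∧ ∀ e ∈ G.edgeSet, ∀ f ∈ M, ∀ g ∈ M, f ≠ g →
    ¬ ((∃ v : V, v ∈ e ∧ v ∈ f) ∧ (∃ v : V, v ∈ e ∧ v ∈ g))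

/-- The matching number `match(G)`: maximum size of a matching of `G`. -/
def matchNum (G : SimpleGraph V) : ℕ :=
  sSup {n | ∃ M : Finset (Sym2 V), IsMatching G M ∧ M.card = n}

/-- The minimum matching number `min-match(G)`:
minimum size of a maximal matching of `G`. -/
def minMatchNum (G : SimpleGraph V) : ℕ :=
  sInf {n | ∃ M : Finset (Sym2 V), IsMaximalMatching G M ∧ M.card = n}

/-- The induced matching number `ind-match(G)`:
maximum size of an induced matching of `G`. -/
def indMatchNum (G : SimpleGraph V) : ℕ :=
  sSup {n | ∃ M : Finset (Sym2 V), IsInducedMatching G M ∧ M.card = n}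

/-- The edge ideal `I(G) ⊆ K[x_v : v ∈ V]`, generated by the products
`x_i * x_j` over the edges `{x_i, x_j}` of `G`. -/
def edgeIdeal (K : Type) [Field K] (G : SimpleGraph V) : Ideal (MvPolynomial V K) :=
  Ideal.span {p | ∃ i j : V, G.Adj i j ∧ p = X i * X j}

/-- `dim(G)`: the Krull dimension of the quotient ring `K[V(G)]/I(G)`. -/
def graphDim (K : Type) [Field K] (G : SimpleGraph V) : WithBot ℕ∞ :=
  ringKrullDim (MvPolynomial V K ⧸ edgeIdeal K G)

/-- The `S`-suspension `G^S` of `G`: a new vertex (here `none : Option V`) is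
joined to every vertex of `G` not belonging to `S`. -/
def suspension (G : SimpleGraph V) (S : Set V) : SimpleGraph (Option V) :=
  SimpleGraph.fromRel (fun u w =>
    (∃ i j : V, u = some i ∧ w = some j ∧ G.Adj i j) ∨
    (∃ i : V, i ∉ S ∧ u = some i ∧ w = none))

lemma coheight_eq_ringKrullDim_quotient {R : Type*} [CommRing R] (p : PrimeSpectrum R) :
    (Order.coheight p : WithBot ℕ∞) = ringKrullDim (R ⧸ p.asIdeal) := by
  rw [ringKrullDim_quotient, Order.coheight_eq_krullDim_Ici]
  rfl

/-- The restriction `K[V] → K[T]` killing the variables outside `T`. -/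
def restrictVars (K : Type*) [CommSemiring K] (T : Set V) :
    MvPolynomial V K →ₐ[K] MvPolynomial T K :=
  aeval fun i => if h : i ∈ T then X ⟨i, h⟩ else 0

lemma restrictVars_X_of_mem {K : Type*} [CommSemiring K] {T : Set V} {i : V} (h : i ∈ T) :
    restrictVars K T (X i) = X ⟨i, h⟩ := by
  simp [restrictVars, h]

lemma restrictVars_X_of_notMem {K : Type*} [CommSemiring K] {T : Set V} {i : V} (h : i ∉ T) :
    restrictVars K T (X i) = 0 := by
  simp [restrictVars, h]

lemma restrictVars_surjective (K : Type*) [CommSemiring K] (T : Set V) :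
    Function.Surjective (restrictVars K T) := by
  have h : (restrictVars K T).comp (rename ((↑) : T → V)) = AlgHom.id K _ := by
    ext i
    simp [restrictVars_X_of_mem i.2]
  exact fun p => ⟨rename ((↑) : T → V) p, DFunLike.congr_fun h p⟩

lemma card_le_graphDim [Finite V] (K : Type) [Field K] (G : SimpleGraph V) {T : Finset V}
    (hT : G.IsIndepSet (T : Set V)) : (T.card : WithBot ℕ∞) ≤ graphDim K G := by
  have hI : edgeIdeal K G ≤ RingHom.ker (restrictVars K (T : Set V)) := by
    refine Ideal.span_le.2 ?_
    rintro _ ⟨i, j, hij, rfl⟩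
    rw [SetLike.mem_coe, RingHom.mem_ker, map_mul]
    by_cases hi : i ∈ (T : Set V)
    · have hj : j ∉ (T : Set V) := fun hj => hT hi hj hij.ne hij
      rw [restrictVars_X_of_notMem hj, mul_zero]
    · rw [restrictVars_X_of_notMem hi, zero_mul]
  have h := ringKrullDim_le_of_surjective
    (Ideal.Quotient.lift (edgeIdeal K G) (restrictVars K (T : Set V)).toRingHom hI)
    (Ideal.Quotient.lift_surjective_of_surjective _ hI (restrictVars_surjective K _))
  simpa [graphDim] using h

lemma ringKrullDim_quotient_le_ncard [Finite V] (K : Type) [Field K] (G : SimpleGraph V)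
    (p : Ideal (MvPolynomial V K ⧸ edgeIdeal K G)) :
    ringKrullDim ((MvPolynomial V K ⧸ edgeIdeal K G) ⧸ p) ≤
      ({i | Ideal.Quotient.mk (edgeIdeal K G) (X i) ∉ p} : Set V).ncard := by
  set T : Set V := {i | Ideal.Quotient.mk (edgeIdeal K G) (X i) ∉ p}
  let φ : MvPolynomial V K →ₐ[K] (MvPolynomial V K ⧸ edgeIdeal K G) ⧸ p :=
    (Ideal.Quotient.mkₐ K p).comp (Ideal.Quotient.mkₐ K (edgeIdeal K G))
  let ψ : MvPolynomial T K →ₐ[K] (MvPolynomial V K ⧸ edgeIdeal K G) ⧸ p :=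
    aeval fun i : T => φ (X i.1)
  have hφ : Function.Surjective φ :=
    (Ideal.Quotient.mkₐ_surjective K p).comp (Ideal.Quotient.mkₐ_surjective K _)
  have h : ψ.comp (restrictVars K T) = φ := by
    ext i
    rw [AlgHom.comp_apply]
    by_cases hi : i ∈ T
    · simp [restrictVars_X_of_mem hi, ψ]
    · rw [restrictVars_X_of_notMem hi, map_zero]
      exact (Ideal.Quotient.eq_zero_iff_mem.2 (not_not.1 hi)).symm
  have hψ : Function.Surjective ψ := by
    rw [← h] at hφ
    exact Function.Surjective.of_comp hφ
  have hdim : ringKrullDim ((MvPolynomial V K ⧸ edgeIdeal K G) ⧸ p) ≤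
      ringKrullDim (MvPolynomial T K) :=
    ringKrullDim_le_of_surjective ψ.toRingHom hψ
  simpa using hdim

/-- The Krull dimension of `K[V]/I(G)` is bounded by the sizes of independent sets of `G`. -/
lemma graphDim_le [Finite V] (K : Type) [Field K] (G : SimpleGraph V) {d : WithBot ℕ∞}
    (hd : ∀ T : Finset V, G.IsIndepSet (T : Set V) → (T.card : WithBot ℕ∞) ≤ d) :
    graphDim K G ≤ d := by
  rw [graphDim, ringKrullDim, Order.krullDim_eq_iSup_coheight]
  refine iSup_le fun p => ?_
  rw [coheight_eq_ringKrullDim_quotient]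
  refine (ringKrullDim_quotient_le_ncard K G p.asIdeal).trans ?_
  have hfin := Set.toFinite {i | Ideal.Quotient.mk (edgeIdeal K G) (X i) ∉ p.asIdeal}
  rw [Set.ncard_eq_toFinset_card _ hfin]
  refine hd _ ?_
  rw [Set.Finite.coe_toFinset]
  intro i hi j hj _ hij
  refine (p.isPrime.mul_mem_iff_mem_or_mem.not.2 (not_or.2 ⟨hi, hj⟩)) ?_
  have hmem : X i * X j ∈ edgeIdeal K G := Ideal.subset_span ⟨i, j, hij, rfl⟩
  rw [← map_mul, Ideal.Quotient.eq_zero_iff_mem.2 hmem]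
  exact zero_mem _

lemma suspension_adj_some {G : SimpleGraph V} {S : Set V} {i j : V} :
    (suspension G S).Adj (some i) (some j) ↔ G.Adj i j := by
  have := G.ne_of_adj (a := i) (b := j)
  simp only [suspension, SimpleGraph.fromRel_adj]
  grind [G.adj_comm i j]

lemma suspension_adj_some_none {G : SimpleGraph V} {S : Set V} {i : V} :
    (suspension G S).Adj (some i) none ↔ i ∉ S := by
  simp [suspension, SimpleGraph.fromRel_adj]

lemma graphDim_le_graphDim_suspension [Finite V] (K : Type) [Field K] (G : SimpleGraph V)
    (S : Set V) : graphDim K G ≤ graphDim K (suspension G S) := by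
  refine graphDim_le K G fun T hT => ?_
  rw [← T.card_map Function.Embedding.some]
  refine card_le_graphDim K _ ?_
  rw [Finset.coe_map]
  rintro _ ⟨i, hi, rfl⟩ _ ⟨j, hj, rfl⟩ hne
  exact fun h => hT hi hj (fun e => hne (congrArg _ e)) (suspension_adj_some.1 h)

lemma card_add_one_le_graphDim_suspension [Finite V] (K : Type) [Field K] {G : SimpleGraph V}
    {S : Finset V} (hS : G.IsIndepSet (S : Set V)) :
    (S.card : WithBot ℕ∞) + 1 ≤ graphDim K (suspension G (S : Set V)) := by
  have h := card_le_graphDim K (suspension G (S : Set V)) (T := S.insertNone) ?_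
  · simpa using h
  · rintro (_ | i) hi (_ | j) hj hne h
    · exact hne rfl
    · exact suspension_adj_some_none.1 h.symm (Finset.some_mem_insertNone.1 hj)
    · exact suspension_adj_some_none.1 h (Finset.some_mem_insertNone.1 hi)
    · exact hS (Finset.some_mem_insertNone.1 hi) (Finset.some_mem_insertNone.1 hj)
        (fun e => hne (congrArg _ e)) (suspension_adj_some.1 h)

lemma graphDim_suspension_le [Finite V] (K : Type) [Field K] (G : SimpleGraph V) (S : Finset V) :
    graphDim K (suspension G (S : Set V)) ≤ max (graphDim K G) (S.card + 1) := by
  refine graphDim_le K _ fun T hT => ?_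
  by_cases hn : none ∈ T
  · refine le_max_of_le_right ?_
    have h : T ⊆ S.insertNone := by
      rintro (_ | i) hi
      · exact Finset.none_mem_insertNone
      · refine Finset.some_mem_insertNone.2 (by_contra fun h => ?_)
        exact hT hi hn (by simp) (suspension_adj_some_none.2 h)
    exact_mod_cast (Finset.card_le_card h).trans_eq S.card_insertNone
  · refine le_max_of_le_left ?_
    rw [← Finset.card_eraseNone_of_not_mem hn]
    refine card_le_graphDim K G fun i hi j hj hne hij => ?_
    exact hT (Finset.mem_eraseNone.1 hi) (Finset.mem_eraseNone.1 hj)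
      (fun e => hne (Option.some_injective _ e)) (suspension_adj_some.2 hij)

/-- If `G` has no isolated vertices and `S` is an independent set of `G`, then
`dim(G^S) = dim(G)` when `0 ≤ |S| ≤ dim(G) - 1`, and `dim(G^S) = dim(G) + 1`
when `|S| = dim(G)`. -/
theorem graphDim_suspension {V : Type} [Fintype V] (G : SimpleGraph V)
    (hiso : ∀ v : V, ∃ w : V, G.Adj v w) (S : Finset V)
    (hS : ∀ v ∈ S, ∀ w ∈ S, ¬ G.Adj v w) (K : Type) [Field K] :
    ((S.card : WithBot ℕ∞) < graphDim K G →
        graphDim K (suspension G (S : Set V)) = graphDim K G) ∧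
      ((S.card : WithBot ℕ∞) = graphDim K G →
        graphDim K (suspension G (S : Set V)) = graphDim K G + 1) := by
  have hS' : G.IsIndepSet (S : Set V) := fun v hv w hw _ => hS v hv w hw
  have hle := graphDim_suspension_le K G S
  refine ⟨fun h => ?_, fun h => ?_⟩
  · rw [max_eq_left (ENat.WithBot.add_one_le_iff.2 h)] at hle
    exact hle.antisymm (graphDim_le_graphDim_suspension K G S)
  · rw [← h] at hle ⊢
    exact (hle.trans (max_le (by exact_mod_cast Nat.le_succ _) le_rfl)).antisymm
      (card_add_one_le_graphDim_suspension K hS')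

end EdgeIdealPaper
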